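/- Suppose every stopping rule is truncatable, i.e. R_N(ψ) → R(ψ) as N → ∞ for every stopping rule ψ, and let 𝓕 be the set of all stopping rules. Then a stopping rule ψ satisfies R(ψ) = inf_{ψ′ ∈ 𝓕} R(ψ′) if and only if, for every n ≥ 1, the inequalities 1{lₙ < Qₙ} ≤ ψₙ ≤ 1{lₙ ≤ Qₙ} hold μⁿ-almost everywhere on Tₙ^ψ = {tₙ^ψ > 0}. -/

import Mathlib

open MeasureTheory ENNReal Filter ProbabilityTheory

namespace SDP

variable {Θ X D : Type*} [MeasurableSpace Θ] [MeasurableSpace X] [MeasurableSpace D]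

/-- The product measure `μⁿ` on `Xⁿ`. -/
noncomputable def pm (μ : Measure X) (n : ℕ) : Measure (Fin n → X) :=
  Measure.pi fun _ => μ

/-- `t_n^ψ = (1-ψ₁)⋯(1-ψ_{n-1})`, with `t₁^ψ ≡ 1`. -/
noncomputable def t (ψ : ∀ n, (Fin n → X) → ℝ≥0∞) : ∀ n, (Fin n → X) → ℝ≥0∞
  | 0, _ => 1
  | 1, _ => 1
  | n + 2, x => t ψ (n + 1) (Fin.init x) * (1 - ψ (n + 1) (Fin.init x))

/-- `s_n^ψ = (1-ψ₁)⋯(1-ψ_{n-1})ψ_n`. -/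
noncomputable def s (ψ : ∀ n, (Fin n → X) → ℝ≥0∞) (n : ℕ) (x : Fin n → X) : ℝ≥0∞ :=
  t ψ n x * ψ n x

/-- A stopping rule: a sequence of measurable functions with values in `[0,1]`. -/
def IsStoppingRule (ψ : ∀ n, (Fin n → X) → ℝ≥0∞) : Prop :=
  (∀ n, Measurable (ψ n)) ∧ ∀ n x, ψ n x ≤ 1

/-- A decision rule: a sequence of measurable functions with values in `D`. -/
def IsDecisionRule (δ : ∀ n, (Fin n → X) → D) : Prop := ∀ n, Measurable (δ n)

/-- `ψ` is truncated at `N`: `ψ_n ≡ 1` for all `n ≥ N`. -/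
def TruncatedAt (ψ : ∀ n, (Fin n → X) → ℝ≥0∞) (N : ℕ) : Prop :=
  ∀ n, N ≤ n → ∀ x, ψ n x = 1

/-- A consistent family of joint probability densities `f_θⁿ` w.r.t. `μⁿ`. -/
def IsDensityFamily (μ : Measure X) (f : Θ → ∀ n, (Fin n → X) → ℝ≥0∞) : Prop :=
  (∀ n, Measurable fun p : Θ × (Fin n → X) => f p.1 n p.2) ∧
  (∀ θ x, f θ 0 x = 1) ∧
  (∀ θ n, ∫⁻ x, f θ n x ∂pm μ n = 1) ∧
  ∀ θ n (x : Fin n → X), ∫⁻ y, f θ (n + 1) (Fin.snoc x y) ∂μ = f θ n x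

/-- The average loss `W(ψ,δ)`. -/
noncomputable def W (π₁ : Measure Θ) (μ : Measure X) (w : Θ → D → ℝ≥0∞)
    (f : Θ → ∀ n, (Fin n → X) → ℝ≥0∞) (ψ : ∀ n, (Fin n → X) → ℝ≥0∞)
    (δ : ∀ n, (Fin n → X) → D) : ℝ≥0∞ :=
  ∑' n : ℕ, ∫⁻ θ, ∫⁻ x, s ψ (n + 1) x * w θ (δ (n + 1) x) * f θ (n + 1) x ∂pm μ (n + 1) ∂π₁

/-- The partial average loss `W_i(ψ,δ)` (integration over `Θᵢ`). -/
noncomputable def Wi (π₁ : Measure Θ) (μ : Measure X) (w : Θ → D → ℝ≥0∞)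
    (f : Θ → ∀ n, (Fin n → X) → ℝ≥0∞) (Θi : Set Θ) (ψ : ∀ n, (Fin n → X) → ℝ≥0∞)
    (δ : ∀ n, (Fin n → X) → D) : ℝ≥0∞ :=
  ∑' n : ℕ,
    ∫⁻ θ in Θi, ∫⁻ x, s ψ (n + 1) x * w θ (δ (n + 1) x) * f θ (n + 1) x ∂pm μ (n + 1) ∂π₁

/-- `P^{π}(τ_ψ = n)`. -/
noncomputable def PtauEq (π₂ : Measure Θ) (μ : Measure X)
    (f : Θ → ∀ n, (Fin n → X) → ℝ≥0∞) (ψ : ∀ n, (Fin n → X) → ℝ≥0∞) (n : ℕ) : ℝ≥0∞ :=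
  ∫⁻ θ, ∫⁻ x, s ψ n x * f θ n x ∂pm μ n ∂π₂

/-- `P^{π}(τ_ψ < ∞)`. -/
noncomputable def Pfin (π₂ : Measure Θ) (μ : Measure X)
    (f : Θ → ∀ n, (Fin n → X) → ℝ≥0∞) (ψ : ∀ n, (Fin n → X) → ℝ≥0∞) : ℝ≥0∞ :=
  ∑' n : ℕ, PtauEq π₂ μ f ψ (n + 1)

/-- The average sample number `N(ψ)` (equal to `∞` if `P^{π₂}(τ_ψ < ∞) < 1`). -/
noncomputable def ASN (π₂ : Measure Θ) (μ : Measure X)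
    (f : Θ → ∀ n, (Fin n → X) → ℝ≥0∞) (ψ : ∀ n, (Fin n → X) → ℝ≥0∞) : ℝ≥0∞ :=
  if Pfin π₂ μ f ψ = 1 then ∑' n : ℕ, ((n : ℝ≥0∞) + 1) * PtauEq π₂ μ f ψ (n + 1) else ⊤

/-- `fⁿ = ∫_Θ f_θⁿ dπ₂(θ)` (in particular `f⁰ ≡ 1`). -/
noncomputable def fbar (π₂ : Measure Θ) (f : Θ → ∀ n, (Fin n → X) → ℝ≥0∞)
    (n : ℕ) (x : Fin n → X) : ℝ≥0∞ :=
  ∫⁻ θ, f θ n x ∂π₂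

/-- `R(ψ) = Σₙ ∫ sₙ^ψ (c n fⁿ + lₙ) dμⁿ` if `P^{π₂}(τ_ψ<∞) = 1`, `∞` otherwise. -/
noncomputable def R (π₂ : Measure Θ) (μ : Measure X) (c : ℝ≥0∞)
    (f : Θ → ∀ n, (Fin n → X) → ℝ≥0∞) (l : ∀ n, (Fin n → X) → ℝ≥0∞)
    (ψ : ∀ n, (Fin n → X) → ℝ≥0∞) : ℝ≥0∞ :=
  if Pfin π₂ μ f ψ = 1 then
    ∑' n : ℕ, ∫⁻ x, s ψ (n + 1) x *
      (c * ((n : ℝ≥0∞) + 1) * fbar π₂ f (n + 1) x + l (n + 1) x) ∂pm μ (n + 1)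
  else ⊤

/-- `R_N(ψ)`, the risk of `ψ` truncated at `N`. -/
noncomputable def RN (π₂ : Measure Θ) (μ : Measure X) (c : ℝ≥0∞)
    (f : Θ → ∀ n, (Fin n → X) → ℝ≥0∞) (l : ∀ n, (Fin n → X) → ℝ≥0∞)
    (N : ℕ) (ψ : ∀ n, (Fin n → X) → ℝ≥0∞) : ℝ≥0∞ :=
  (∑ n ∈ Finset.range (N - 1), ∫⁻ x, s ψ (n + 1) x *
      (c * ((n : ℝ≥0∞) + 1) * fbar π₂ f (n + 1) x + l (n + 1) x) ∂pm μ (n + 1)) +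
  ∫⁻ x, t ψ N x * (c * (N : ℝ≥0∞) * fbar π₂ f N x + l N x) ∂pm μ N

/-- `Vₙᴺ`, defined backwards from `V_Nᴺ = l_N` by `Vₙᴺ = min{lₙ, Qₙᴺ}`. -/
noncomputable def V (μ : Measure X) (c : ℝ≥0∞) (fb l : ∀ n, (Fin n → X) → ℝ≥0∞)
    (N n : ℕ) (x : Fin n → X) : ℝ≥0∞ :=
  if h : n < N then
    min (l n x) (c * fb n x + ∫⁻ y, V μ c fb l N (n + 1) (Fin.snoc x y) ∂μ)
  else l n x
termination_by N - n
decreasing_by omega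

/-- `Qₙᴺ = c fⁿ + ∫ Vₙ₊₁ᴺ(⋅,y) dμ(y)`. -/
noncomputable def Q (μ : Measure X) (c : ℝ≥0∞) (fb l : ∀ n, (Fin n → X) → ℝ≥0∞)
    (N n : ℕ) (x : Fin n → X) : ℝ≥0∞ :=
  c * fb n x + ∫⁻ y, V μ c fb l N (n + 1) (Fin.snoc x y) ∂μ

/-- `Vₙ = lim_{N→∞} Vₙᴺ` (the sequence is nonincreasing in `N`, so the limit is the inf). -/
noncomputable def Vlim (μ : Measure X) (c : ℝ≥0∞) (fb l : ∀ n, (Fin n → X) → ℝ≥0∞)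
    (n : ℕ) (x : Fin n → X) : ℝ≥0∞ :=
  ⨅ N, V μ c fb l N n x

/-- `Qₙ = lim_{N→∞} Qₙᴺ = c fⁿ + ∫ Vₙ₊₁(⋅,y) dμ(y)`. -/
noncomputable def Qlim (μ : Measure X) (c : ℝ≥0∞) (fb l : ∀ n, (Fin n → X) → ℝ≥0∞)
    (n : ℕ) (x : Fin n → X) : ℝ≥0∞ :=
  c * fb n x + ∫⁻ y, Vlim μ c fb l (n + 1) (Fin.snoc x y) ∂μ

end SDP

namespace SDP

section Truncation

variable {Θ X : Type*} {ψ ψ' : ∀ n, (Fin n → X) → ℝ≥0∞}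

lemma t_succ_snoc (ψ : ∀ n, (Fin n → X) → ℝ≥0∞) (n : ℕ) (x : Fin (n + 1) → X) (y : X) :
    t ψ (n + 2) (Fin.snoc x y) = t ψ (n + 1) x * (1 - ψ (n + 1) x) := by
  simp [t]

lemma t_le_one (ψ : ∀ n, (Fin n → X) → ℝ≥0∞) : ∀ n x, t ψ n x ≤ 1
  | 0, _ => le_rfl
  | 1, _ => le_rfl
  | n + 2, x => by
    rw [t]
    exact mul_le_one' (t_le_one ψ (n + 1) _) tsub_le_self

lemma t_congr : ∀ {n : ℕ}, (∀ m < n, ψ m = ψ' m) → t ψ n = t ψ' n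
  | 0, _ => rfl
  | 1, _ => rfl
  | n + 2, h => by
    funext x
    rw [t, t, t_congr (n := n + 1) fun m hm => h m (by omega), h (n + 1) (by omega)]

lemma s_congr {n : ℕ} (h : ∀ m ≤ n, ψ m = ψ' m) : s ψ n = s ψ' n := by
  funext x
  rw [s, s, t_congr fun m hm => h m hm.le, h n le_rfl]

/-- The value at time `m` of a function of the first `n` coordinates (and `0` if `m < n`). -/
def horizonAt {n : ℕ} (T : (Fin n → X) → ℕ) (m : ℕ) (x : Fin m → X) : ℕ :=
  if h : n ≤ m then T fun i => x (Fin.castLE h i) else 0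

lemma horizonAt_self {n : ℕ} (T : (Fin n → X) → ℕ) (x : Fin n → X) :
    horizonAt T n x = T x := by
  simp [horizonAt]

lemma horizonAt_snoc {n m : ℕ} (h : n ≤ m) (T : (Fin n → X) → ℕ) (x : Fin m → X) (y : X) :
    horizonAt T (m + 1) (Fin.snoc x y) = horizonAt T m x := by
  rw [horizonAt, horizonAt, dif_pos h, dif_pos (by omega)]
  congr 1
  funext i
  exact Fin.snoc_castSucc (α := fun _ => X) y x (Fin.castLE h i)

variable [MeasurableSpace Θ] [MeasurableSpace X]

lemma measurable_snoc (n : ℕ) :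
    Measurable fun p : (Fin n → X) × X => (Fin.snoc p.1 p.2 : Fin (n + 1) → X) := by
  refine measurable_pi_lambda _ fun i => ?_
  refine Fin.lastCases ?_ (fun j => ?_) i
  · simpa using measurable_snd
  · simpa using (measurable_pi_apply j).fun_comp measurable_fst

lemma measurable_init (n : ℕ) :
    Measurable fun x : Fin (n + 1) → X => (Fin.init x : Fin n → X) :=
  measurable_pi_lambda _ fun i => measurable_pi_apply i.castSucc

/-- Fubini for splitting off the last coordinate. -/
lemma lintegral_pm_succ (μ : Measure X) [SigmaFinite μ] (n : ℕ)
    {g : (Fin (n + 1) → X) → ℝ≥0∞} (hg : Measurable g) :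
    ∫⁻ x, g x ∂pm μ (n + 1) = ∫⁻ x, ∫⁻ y, g (Fin.snoc x y) ∂μ ∂pm μ n := by
  have h := measurePreserving_piFinSuccAbove (fun _ : Fin (n + 1) => μ) (Fin.last n)
  have h2 := (h.symm (MeasurableEquiv.piFinSuccAbove (fun _ : Fin (n + 1) => X)
    (Fin.last n))).lintegral_comp hg
  rw [pm, ← h2, lintegral_prod_symm' (fun p => g ((MeasurableEquiv.piFinSuccAbove (fun _ => X)
    (Fin.last n)).symm p)) (hg.comp (MeasurableEquiv.measurable _))]
  refine lintegral_congr fun x => lintegral_congr fun y => ?_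
  simp [MeasurableEquiv.piFinSuccAbove, Fin.insertNthEquiv]

lemma measurable_lintegral_snoc (μ : Measure X) [SigmaFinite μ] {n : ℕ}
    {g : (Fin (n + 1) → X) → ℝ≥0∞} (hg : Measurable g) :
    Measurable fun x : Fin n → X => ∫⁻ y, g (Fin.snoc x y) ∂μ :=
  Measurable.lintegral_prod_right' (f := fun p : (Fin n → X) × X => g (Fin.snoc p.1 p.2))
    (hg.comp (measurable_snoc n))

lemma measurable_of_snoc_right {n : ℕ} {g : (Fin (n + 1) → X) → ℝ≥0∞} (hg : Measurable g)
    (x : Fin n → X) : Measurable fun y : X => g (Fin.snoc x y) :=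
  hg.comp ((measurable_snoc n).comp measurable_prodMk_left)

lemma measurable_t (hψ : IsStoppingRule ψ) : ∀ n, Measurable (t ψ n)
  | 0 => measurable_const
  | 1 => measurable_const
  | n + 2 => by
    have h : t ψ (n + 2) =
        (fun x => t ψ (n + 1) x * (1 - ψ (n + 1) x)) ∘ (fun x => Fin.init x) := rfl
    rw [h]
    exact ((measurable_t hψ (n + 1)).mul (measurable_const.sub (hψ.1 _))).comp
      (measurable_init _)

lemma measurable_s (hψ : IsStoppingRule ψ) (n : ℕ) : Measurable (s ψ n) :=
  (measurable_t hψ n).mul (hψ.1 n)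

/-- A consistent sequence of probability densities with respect to the powers of `μ`. -/
structure IsConsistentDensity (μ : Measure X) (fb : ∀ n, (Fin n → X) → ℝ≥0∞) : Prop where
  measurable : ∀ n, Measurable (fb n)
  lintegral_eq_one : ∀ n, ∫⁻ x, fb n x ∂pm μ n = 1
  lintegral_snoc : ∀ n (x : Fin n → X), ∫⁻ y, fb (n + 1) (Fin.snoc x y) ∂μ = fb n x

/-- The cost contributed by stopping at time `n + 1`. -/
noncomputable def stopCost (μ : Measure X) (c : ℝ≥0∞) (fb l ψ : ∀ n, (Fin n → X) → ℝ≥0∞)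
    (n : ℕ) : ℝ≥0∞ :=
  ∫⁻ x, s ψ (n + 1) x * (c * ((n : ℝ≥0∞) + 1) * fb (n + 1) x + l (n + 1) x) ∂pm μ (n + 1)

/-- The cost of following `ψ` before time `k + 1` and paying the terminal loss `U` at time
`k + 1`. -/
noncomputable def partialRisk (μ : Measure X) (c : ℝ≥0∞) (fb l U : ∀ n, (Fin n → X) → ℝ≥0∞)
    (k : ℕ) (ψ : ∀ n, (Fin n → X) → ℝ≥0∞) : ℝ≥0∞ :=
  ∑ n ∈ Finset.range k, stopCost μ c fb l ψ n +
    ∫⁻ x, t ψ (k + 1) x * (c * ((k : ℝ≥0∞) + 1) * fb (k + 1) x + U (k + 1) x) ∂pm μ (k + 1)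

/-- The risk of `ψ`, expressed through the averaged density `fb`. -/
noncomputable def risk (μ : Measure X) (c : ℝ≥0∞) (fb l ψ : ∀ n, (Fin n → X) → ℝ≥0∞) :
    ℝ≥0∞ :=
  if ∑' n : ℕ, ∫⁻ x, s ψ (n + 1) x * fb (n + 1) x ∂pm μ (n + 1) = 1 then
    ∑' n : ℕ, stopCost μ c fb l ψ n
  else ⊤

section Costs

variable {μ : Measure X} [SigmaFinite μ] {c : ℝ≥0∞} {fb l U : ∀ n, (Fin n → X) → ℝ≥0∞}

lemma partialRisk_succ (hfb : IsConsistentDensity μ fb) (hl : ∀ n, Measurable (l n))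
    {k : ℕ} (hU : Measurable (U (k + 2))) (hψ : IsStoppingRule ψ) :
    partialRisk μ c fb l U (k + 1) ψ =
      ∑ n ∈ Finset.range k, stopCost μ c fb l ψ n +
        ∫⁻ x, t ψ (k + 1) x * (c * ((k : ℝ≥0∞) + 1) * fb (k + 1) x +
          (ψ (k + 1) x * l (k + 1) x + (1 - ψ (k + 1) x) *
            (c * fb (k + 1) x + ∫⁻ y, U (k + 2) (Fin.snoc x y) ∂μ))) ∂pm μ (k + 1) := by
  have ht := measurable_t hψ
  have hs := measurable_s hψ
  have hm := hfb.measurable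
  rw [partialRisk, Finset.sum_range_succ, add_assoc, stopCost]
  congr 1
  rw [lintegral_pm_succ μ (k + 1)
      (g := fun x => t ψ (k + 2) x * (c * (((k + 1 : ℕ) : ℝ≥0∞) + 1) * fb (k + 2) x +
        U (k + 2) x)) (by fun_prop),
    ← lintegral_add_left (f := fun x => s ψ (k + 1) x * (c * ((k : ℝ≥0∞) + 1) *
      fb (k + 1) x + l (k + 1) x)) (by fun_prop)]
  refine lintegral_congr fun x => ?_
  have h1 : ∫⁻ y, t ψ (k + 1 + 1) (Fin.snoc x y) *
      (c * (((k + 1 : ℕ) : ℝ≥0∞) + 1) * fb (k + 1 + 1) (Fin.snoc x y) +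
        U (k + 1 + 1) (Fin.snoc x y)) ∂μ =
      t ψ (k + 1) x * (1 - ψ (k + 1) x) * (c * (((k + 1 : ℕ) : ℝ≥0∞) + 1) * fb (k + 1) x +
        ∫⁻ y, U (k + 1 + 1) (Fin.snoc x y) ∂μ) := by
    simp_rw [t_succ_snoc]
    have hf := measurable_of_snoc_right (hm (k + 1 + 1)) x
    have hu := measurable_of_snoc_right hU x
    rw [lintegral_const_mul _ ((measurable_const.fun_mul hf).fun_add hu),
      lintegral_add_left (measurable_const.fun_mul hf), lintegral_const_mul _ hf,
      hfb.lintegral_snoc]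
  rw [h1, s]
  have h2 : ψ (k + 1) x + (1 - ψ (k + 1) x) = 1 := add_tsub_cancel_of_le (hψ.2 _ _)
  generalize ψ (k + 1) x = a at *
  generalize 1 - a = b at *
  push_cast
  calc _ = t ψ (k + 1) x * ((a + b) * (c * ((k : ℝ≥0∞) + 1) * fb (k + 1) x) +
        (a * l (k + 1) x + b * (c * fb (k + 1) x +
          ∫⁻ y, U (k + 1 + 1) (Fin.snoc x y) ∂μ))) := by ring
    _ = _ := by rw [h2, one_mul]

lemma min_le_mul_add_mul {p a b : ℝ≥0∞} (hp : p ≤ 1) : min a b ≤ p * a + (1 - p) * b := by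
  calc min a b = (p + (1 - p)) * min a b := by rw [add_tsub_cancel_of_le hp, one_mul]
    _ = p * min a b + (1 - p) * min a b := add_mul _ _ _
    _ ≤ _ := by gcongr <;> simp

lemma sum_stopProb_add (hfb : IsConsistentDensity μ fb) (hψ : IsStoppingRule ψ) (k : ℕ) :
    ∑ n ∈ Finset.range k, ∫⁻ x, s ψ (n + 1) x * fb (n + 1) x ∂pm μ (n + 1) +
      ∫⁻ x, t ψ (k + 1) x * fb (k + 1) x ∂pm μ (k + 1) = 1 := by
  induction k with
  | zero => simpa [t] using hfb.lintegral_eq_one 1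
  | succ k ih =>
    rw [Finset.sum_range_succ, add_assoc, ← ih]
    congr 1
    have ht := measurable_t hψ
    have hm := hfb.measurable
    rw [lintegral_pm_succ μ (k + 1) ((ht _).fun_mul (hm _)),
      ← lintegral_add_left ((measurable_s hψ _).fun_mul (hm _))]
    refine lintegral_congr fun x => ?_
    have h2 : ψ (k + 1) x + (1 - ψ (k + 1) x) = 1 := add_tsub_cancel_of_le (hψ.2 _ _)
    simp_rw [t_succ_snoc]
    rw [lintegral_const_mul _ (measurable_of_snoc_right (hm (k + 1 + 1)) x),
      hfb.lintegral_snoc, s, ← add_mul, ← mul_add, h2, mul_one]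

/-- A rule whose partial risks stay below a finite bound stops almost surely, and its risk
obeys the same bound. -/
lemma risk_le_of_partialRisk_le (hfb : IsConsistentDensity μ fb) (hψ : IsStoppingRule ψ)
    (hc : 0 < c) (hc' : c ≠ ⊤) {C : ℝ≥0∞} (hC : C ≠ ⊤) {k₀ : ℕ}
    (h : ∀ k, k₀ ≤ k → partialRisk μ c fb l U k ψ ≤ C) : risk μ c fb l ψ ≤ C := by
  have hm := hfb.measurable
  have ht := measurable_t hψ
  have hbound : ∀ k, k₀ ≤ k → ∫⁻ x, t ψ (k + 1) x * fb (k + 1) x ∂pm μ (k + 1) ≤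
      C / c * ((k + 1 : ℕ) : ℝ≥0∞)⁻¹ := by
    intro k hk
    have h1 : c * ((k + 1 : ℕ) : ℝ≥0∞) *
        ∫⁻ x, t ψ (k + 1) x * fb (k + 1) x ∂pm μ (k + 1) ≤ C := by
      rw [← lintegral_const_mul _ ((ht _).fun_mul (hm _))]
      refine le_trans (lintegral_mono fun x => ?_) (le_add_self.trans (h k hk))
      push_cast
      calc _ = t ψ (k + 1) x * (c * ((k : ℝ≥0∞) + 1) * fb (k + 1) x) := by ring
        _ ≤ _ := by gcongr; exact le_self_add
    have hk0 : ((k + 1 : ℕ) : ℝ≥0∞) ≠ 0 := by simp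
    rw [← div_eq_mul_inv, ENNReal.le_div_iff_mul_le (Or.inl hk0) (Or.inl (by finiteness)),
      ENNReal.le_div_iff_mul_le (Or.inl hc.ne') (Or.inl hc')]
    calc _ = _ := by ring
      _ ≤ C := h1
  have htend : Tendsto (fun k => ∫⁻ x, t ψ (k + 1) x * fb (k + 1) x ∂pm μ (k + 1))
      atTop (nhds 0) := by
    have hz : Tendsto (fun k : ℕ => C / c * ((k + 1 : ℕ) : ℝ≥0∞)⁻¹) atTop (nhds 0) := by
      have := ENNReal.Tendsto.const_mul (a := C / c)
        ((tendsto_add_atTop_iff_nat 1).2 ENNReal.tendsto_inv_nat_nhds_zero)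
        (Or.inr (ENNReal.div_ne_top hC hc.ne'))
      simpa using this
    exact tendsto_of_tendsto_of_tendsto_of_le_of_le' tendsto_const_nhds hz
      (Eventually.of_forall fun _ => zero_le) ((eventually_ge_atTop k₀).mono hbound)
  have hprob : ∑' n : ℕ, ∫⁻ x, s ψ (n + 1) x * fb (n + 1) x ∂pm μ (n + 1) = 1 := by
    have h1 := (ENNReal.tendsto_nat_tsum
      (fun n => ∫⁻ x, s ψ (n + 1) x * fb (n + 1) x ∂pm μ (n + 1))).add htend
    simp_rw [sum_stopProb_add hfb hψ, add_zero] at h1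
    exact tendsto_nhds_unique h1 tendsto_const_nhds
  rw [risk, if_pos hprob]
  refine le_of_tendsto (ENNReal.tendsto_nat_tsum _) ?_
  filter_upwards [eventually_ge_atTop k₀] with k hk
  exact le_self_add.trans (h k hk)

end Costs

section Backward

variable {μ : Measure X} {c : ℝ≥0∞} {fb l : ∀ n, (Fin n → X) → ℝ≥0∞}

lemma V_of_lt {N n : ℕ} (h : n < N) (x : Fin n → X) :
    V μ c fb l N n x = min (l n x) (Q μ c fb l N n x) := by
  rw [V, dif_pos h, Q]

lemma V_of_le {N n : ℕ} (h : N ≤ n) (x : Fin n → X) : V μ c fb l N n x = l n x := by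
  rw [V, dif_neg h.not_gt]

lemma V_le (N n : ℕ) (x : Fin n → X) : V μ c fb l N n x ≤ l n x := by
  rcases lt_or_ge n N with h | h
  · rw [V_of_lt h]; exact min_le_left _ _
  · rw [V_of_le h]

lemma V_succ_le (N : ℕ) : ∀ (d n : ℕ), N ≤ n + d → ∀ x : Fin n → X,
    V μ c fb l (N + 1) n x ≤ V μ c fb l N n x := by
  intro d
  induction d with
  | zero =>
    intro n h x
    rw [V_of_le (N := N) (by omega)]
    exact V_le _ _ _
  | succ d ih =>
    intro n h x
    rcases lt_or_ge n N with hn | hn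
    · rw [V_of_lt hn, V_of_lt (by omega), Q, Q]
      gcongr with y
      exact ih (n + 1) (by omega) _
    · rw [V_of_le hn]
      exact V_le _ _ _

lemma V_antitone (n : ℕ) (x : Fin n → X) : Antitone fun N => V μ c fb l N n x :=
  antitone_nat_of_succ_le fun N => V_succ_le N N n (by omega) x

lemma Vlim_le (N n : ℕ) (x : Fin n → X) : Vlim μ c fb l n x ≤ V μ c fb l N n x :=
  iInf_le _ N

lemma min_le_Vlim (n : ℕ) (x : Fin n → X) :
    min (l n x) (Qlim μ c fb l n x) ≤ Vlim μ c fb l n x := by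
  refine le_iInf fun N => ?_
  rcases lt_or_ge n N with h | h
  · rw [V_of_lt h, Q, Qlim]
    gcongr with y
    exact Vlim_le _ _ _
  · rw [V_of_le h]
    exact min_le_left _ _

variable [SigmaFinite μ]

lemma measurable_V (hm : ∀ n, Measurable (fb n)) (hl : ∀ n, Measurable (l n)) (N : ℕ) :
    ∀ d n : ℕ, N ≤ n + d → Measurable (V μ c fb l N n) := by
  intro d
  induction d with
  | zero =>
    intro n h
    rw [show V μ c fb l N n = l n from funext fun x => V_of_le (by omega) x]
    exact hl n
  | succ d ih =>
    intro n h
    rcases lt_or_ge n N with hn | hn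
    · rw [show V μ c fb l N n = fun x => min (l n x) (Q μ c fb l N n x) from
        funext fun x => V_of_lt hn x]
      exact (hl n).min ((measurable_const.mul (hm n)).add
        (measurable_lintegral_snoc μ (ih (n + 1) (by omega))))
    · rw [show V μ c fb l N n = l n from funext fun x => V_of_le hn x]
      exact hl n

lemma measurable_V' (hm : ∀ n, Measurable (fb n)) (hl : ∀ n, Measurable (l n)) (N n : ℕ) :
    Measurable (V μ c fb l N n) := measurable_V hm hl N N n (by omega)

lemma measurable_Q (hm : ∀ n, Measurable (fb n)) (hl : ∀ n, Measurable (l n)) (N n : ℕ) :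
    Measurable (Q μ c fb l N n) :=
  (measurable_const.mul (hm n)).add (measurable_lintegral_snoc μ (measurable_V' hm hl N (n + 1)))

lemma measurable_Vlim (hm : ∀ n, Measurable (fb n)) (hl : ∀ n, Measurable (l n)) (n : ℕ) :
    Measurable (Vlim μ c fb l n) :=
  Measurable.iInf fun N => measurable_V' hm hl N n

lemma measurable_Qlim (hm : ∀ n, Measurable (fb n)) (hl : ∀ n, Measurable (l n)) (n : ℕ) :
    Measurable (Qlim μ c fb l n) :=
  (measurable_const.mul (hm n)).add (measurable_lintegral_snoc μ (measurable_Vlim hm hl (n + 1)))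

end Backward

section Switching

lemma measurable_horizonAt {n : ℕ} {T : (Fin n → X) → ℕ} (hT : Measurable T) (m : ℕ) :
    Measurable (horizonAt T m) := by
  unfold horizonAt
  split_ifs with h
  · exact hT.comp (measurable_pi_lambda _ fun i => measurable_pi_apply _)
  · exact measurable_const

open scoped Classical in
/-- Follow `ψ` before time `n`, then the rule that is optimal among those truncated at the
horizon `T`, which depends on the first `n` observations. -/
noncomputable def switch (μ : Measure X) (c : ℝ≥0∞) (fb l ψ : ∀ n, (Fin n → X) → ℝ≥0∞) {n : ℕ}
    (T : (Fin n → X) → ℕ) (m : ℕ) (x : Fin m → X) : ℝ≥0∞ :=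
  if m < n then ψ m x
  else if horizonAt T m x ≤ m then 1
  else if l m x ≤ Q μ c fb l (horizonAt T m x) m x then 1
  else 0

variable {μ : Measure X} {c : ℝ≥0∞} {fb l : ∀ n, (Fin n → X) → ℝ≥0∞}

lemma switch_mul_add {n m : ℕ} (h : n ≤ m) (T : (Fin n → X) → ℕ) (x : Fin m → X) :
    switch μ c fb l ψ T m x * l m x + (1 - switch μ c fb l ψ T m x) *
        Q μ c fb l (horizonAt T m x) m x = V μ c fb l (horizonAt T m x) m x := by
  rw [switch, if_neg h.not_gt]
  split_ifs with h1 h2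
  · simp [V_of_le h1]
  · simp [V_of_lt (not_le.1 h1), h2]
  · simp [V_of_lt (not_le.1 h1), (not_le.1 h2).le]

variable [SigmaFinite μ]

lemma measurable_apply_horizonAt {n m : ℕ} {T : (Fin n → X) → ℕ} (hT : Measurable T)
    {g : ℕ → (Fin m → X) → ℝ≥0∞} (hg : ∀ N, Measurable (g N)) :
    Measurable fun x => g (horizonAt T m x) x :=
  (measurable_from_prod_countable_right (f := fun p : ℕ × (Fin m → X) => g p.1 p.2) hg).comp
    ((measurable_horizonAt hT m).prodMk measurable_id)

lemma isStoppingRule_switch (hm : ∀ n, Measurable (fb n)) (hl : ∀ n, Measurable (l n))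
    (hψ : IsStoppingRule ψ) {n : ℕ} {T : (Fin n → X) → ℕ} (hT : Measurable T) :
    IsStoppingRule (switch μ c fb l ψ T) := by
  constructor
  · intro m
    refine Measurable.ite (MeasurableSet.const _) (hψ.1 m) (Measurable.ite ?_ measurable_const
      (Measurable.ite ?_ measurable_const measurable_const))
    · exact measurable_horizonAt hT m measurableSet_Iic
    · exact measurableSet_le (hl m)
        (measurable_apply_horizonAt hT fun N => measurable_Q hm hl N m)
  · intro m x
    unfold switch
    split_ifs
    · exact hψ.2 m x
    all_goals simp

/-- Any initial segment of a stopping rule can be continued so that the total risk exceeds the partial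
risk with terminal loss `Vlim` by an arbitrarily small amount. -/
lemma exists_risk_le_partialRisk_Vlim_add (hfb : IsConsistentDensity μ fb)
    (hl : ∀ n, Measurable (l n)) (hc : 0 < c) (hc' : c ≠ ⊤) (hψ : IsStoppingRule ψ) (k : ℕ)
    (hk : partialRisk μ c fb l (Vlim μ c fb l) k ψ ≠ ⊤) {ε : ℝ≥0∞} (hε : ε ≠ 0) (hε' : ε ≠ ⊤) :
    ∃ ψ' : ∀ n, (Fin n → X) → ℝ≥0∞, IsStoppingRule ψ' ∧ (∀ m ≤ k, ψ' m = ψ m) ∧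
      risk μ c fb l ψ' ≤ partialRisk μ c fb l (Vlim μ c fb l) k ψ + ε := by
  classical
  have hm := hfb.measurable
  have : SigmaFinite (pm μ (k + 1)) := by unfold pm; infer_instance
  obtain ⟨g, hg0, hgm, hg⟩ := exists_pos_lintegral_lt_of_sigmaFinite (pm μ (k + 1)) hε
  have hex : ∀ x : Fin (k + 1) → X,
      ∃ N, V μ c fb l N (k + 1) x ≤ Vlim μ c fb l (k + 1) x + g x := by
    intro x
    rcases eq_or_ne (Vlim μ c fb l (k + 1) x) ⊤ with h | h
    · exact ⟨0, by simp [h]⟩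
    · have h1 : (⨅ N, V μ c fb l N (k + 1) x) < Vlim μ c fb l (k + 1) x + g x :=
        ENNReal.lt_add_right h (by simpa using (hg0 x).ne')
      obtain ⟨N, hN⟩ := iInf_lt_iff.1 h1
      exact ⟨N, hN.le⟩
  let T : (Fin (k + 1) → X) → ℕ := fun x => Nat.find (hex x)
  have hT : Measurable T := measurable_find hex fun N =>
    measurableSet_le (measurable_V' hm hl N _)
      ((measurable_Vlim hm hl _).add hgm.coe_nnreal_ennreal)
  have hTV : ∀ x, V μ c fb l (T x) (k + 1) x ≤ Vlim μ c fb l (k + 1) x + g x :=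
    fun x => Nat.find_spec (hex x)
  have hψ' := isStoppingRule_switch (μ := μ) (c := c) hm hl hψ hT
  have hagree : ∀ m ≤ k, switch μ c fb l ψ T m = ψ m := by
    intro m hmk
    funext x
    rw [switch, if_pos (by omega)]
  refine ⟨_, hψ', hagree, ?_⟩
  let U : ∀ m, (Fin m → X) → ℝ≥0∞ := fun m x => V μ c fb l (horizonAt T m x) m x
  have hU : ∀ m, Measurable (U m) := fun m =>
    measurable_apply_horizonAt hT fun N => measurable_V' hm hl N m
  have hstep : ∀ d, partialRisk μ c fb l U (k + d) (switch μ c fb l ψ T) =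
      partialRisk μ c fb l U k (switch μ c fb l ψ T) := by
    intro d
    induction d with
    | zero => rfl
    | succ d ih =>
      rw [← ih, ← add_assoc, partialRisk_succ hfb hl (hU _) hψ', partialRisk]
      congr 1
      refine lintegral_congr fun x => ?_
      have h1 := switch_mul_add (μ := μ) (c := c) (fb := fb) (l := l) (ψ := ψ)
        (show k + 1 ≤ k + d + 1 by omega) T x
      have h2 : c * fb (k + d + 1) x + ∫⁻ y, U (k + d + 2) (Fin.snoc x y) ∂μ =
          Q μ c fb l (horizonAt T (k + d + 1) x) (k + d + 1) x := by
        simp only [U, Q, horizonAt_snoc (show k + 1 ≤ k + d + 1 by omega)]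
      rw [h2, h1]
  have hbase : partialRisk μ c fb l U k (switch μ c fb l ψ T) ≤
      partialRisk μ c fb l (Vlim μ c fb l) k ψ + ε := by
    rw [partialRisk, partialRisk, add_assoc]
    have ht : t (switch μ c fb l ψ T) (k + 1) = t ψ (k + 1) :=
      t_congr fun m hmk => hagree m (by omega)
    rw [ht]
    gcongr ?_ + ?_
    · refine (Finset.sum_congr rfl fun n hn => ?_).le
      have hnk := Finset.mem_range.1 hn
      rw [stopCost, stopCost, s_congr fun m hmn => hagree m (by omega)]
    · refine le_trans (le_trans (lintegral_mono fun x => ?_)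
        (lintegral_add_right _ hgm.coe_nnreal_ennreal).le) (by gcongr)
      have hx : U (k + 1) x ≤ Vlim μ c fb l (k + 1) x + g x := by
        simpa only [U, horizonAt_self] using hTV x
      calc _ ≤ t ψ (k + 1) x * (c * ((k : ℝ≥0∞) + 1) * fb (k + 1) x +
            (Vlim μ c fb l (k + 1) x + g x)) := by gcongr
        _ = t ψ (k + 1) x * (c * ((k : ℝ≥0∞) + 1) * fb (k + 1) x +
            Vlim μ c fb l (k + 1) x) + t ψ (k + 1) x * g x := by ring
        _ ≤ _ := by
          gcongr
          exact mul_le_of_le_one_left' (t_le_one ψ _ x)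
  refine risk_le_of_partialRisk_le (U := U) hfb hψ' hc hc' (by finiteness) (k₀ := k)
    fun j hj => ?_
  obtain ⟨d, rfl⟩ := Nat.exists_eq_add_of_le hj
  exact (hstep d).le.trans hbase

end Switching

section Truncatable

variable {μ : Measure X} [SigmaFinite μ] {c : ℝ≥0∞} {fb l : ∀ n, (Fin n → X) → ℝ≥0∞}

lemma partialRisk_V_le (hfb : IsConsistentDensity μ fb) (hl : ∀ n, Measurable (l n))
    (hψ : IsStoppingRule ψ) {k N : ℕ} (hkN : k ≤ N) :
    partialRisk μ c fb l (V μ c fb l (N + 1)) k ψ ≤ partialRisk μ c fb l l N ψ := by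
  induction hkN using Nat.decreasingInduction with
  | self =>
    refine le_of_eq ?_
    rw [partialRisk, partialRisk]
    simp_rw [V_of_le (le_refl (N + 1))]
  | of_succ k hk ih =>
    refine le_trans ?_ ih
    rw [partialRisk_succ hfb hl (measurable_V' hfb.measurable hl _ _) hψ, partialRisk]
    gcongr with x
    rw [V_of_lt (by omega)]
    exact min_le_mul_add_mul (hψ.2 _ _)

lemma partialRisk_Vlim_le (hfb : IsConsistentDensity μ fb) (hl : ∀ n, Measurable (l n))
    (hψ : IsStoppingRule ψ)
    (htend : Tendsto (fun N => partialRisk μ c fb l l N ψ) atTop (nhds (risk μ c fb l ψ)))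
    (k : ℕ) : partialRisk μ c fb l (Vlim μ c fb l) k ψ ≤ risk μ c fb l ψ := by
  refine ge_of_tendsto htend ?_
  filter_upwards [eventually_ge_atTop k] with N hN
  refine le_trans ?_ (partialRisk_V_le hfb hl hψ hN)
  unfold partialRisk
  gcongr with x
  exact Vlim_le _ _ _

lemma Vlim_le_Q_of_lintegral_ne_top (hm : ∀ n, Measurable (fb n)) (hl : ∀ n, Measurable (l n))
    {n N : ℕ} {x : Fin n → X}
    (h : ∫⁻ y, V μ c fb l N (n + 1) (Fin.snoc x y) ∂μ ≠ ⊤) :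
    Vlim μ c fb l n x ≤ Qlim μ c fb l n x := by
  have h1 : ∀ y, Vlim μ c fb l (n + 1) (Fin.snoc x y) =
      ⨅ M, V μ c fb l (M + N) (n + 1) (Fin.snoc x y) := fun y =>
    le_antisymm (le_iInf fun M => Vlim_le _ _ _)
      (le_iInf fun M => (iInf_le _ M).trans (V_antitone _ _ (Nat.le_add_right M N)))
  simp_rw [Qlim, h1]
  rw [lintegral_iInf (fun M => measurable_of_snoc_right (measurable_V' hm hl _ _) x)
    (fun a b hab y => V_antitone _ _ (by omega)) (by simpa using h), ENNReal.add_iInf]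
  refine le_iInf fun M => ?_
  calc Vlim μ c fb l n x ≤ V μ c fb l (M + N + n + 1) n x := Vlim_le _ _ _
    _ ≤ Q μ c fb l (M + N + n + 1) n x := by
      rw [V_of_lt (by omega)]
      exact min_le_right _ _
    _ ≤ _ := by
      rw [Q]
      gcongr with y
      exact V_antitone _ _ (by omega)

/-- If every rule is truncatable, the optimality equation holds along any rule of finite
partial risk. -/
lemma Vlim_eq_min_ae (hfb : IsConsistentDensity μ fb) (hl : ∀ n, Measurable (l n))
    (hc : 0 < c) (hc' : c ≠ ⊤)
    (htend : ∀ φ : ∀ n, (Fin n → X) → ℝ≥0∞, IsStoppingRule φ →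
      Tendsto (fun N => partialRisk μ c fb l l N φ) atTop (nhds (risk μ c fb l φ)))
    (hψ : IsStoppingRule ψ) {k : ℕ}
    (hk : partialRisk μ c fb l (Vlim μ c fb l) k ψ ≠ ⊤) :
    ∀ᵐ x ∂pm μ (k + 1), 0 < t ψ (k + 1) x →
      Vlim μ c fb l (k + 1) x = min (l (k + 1) x) (Qlim μ c fb l (k + 1) x) := by
  classical
  have hm := hfb.measurable
  let A : Set (Fin (k + 1) → X) := {x | l (k + 1) x ≤ Qlim μ c fb l (k + 1) x}
  have hA : MeasurableSet A := measurableSet_le (hl _) (measurable_Qlim hm hl _)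
  let φ : ∀ n, (Fin n → X) → ℝ≥0∞ := Function.update ψ (k + 1) (A.indicator 1)
  have hφk : φ (k + 1) = A.indicator 1 := Function.update_self ..
  have hφ_ne : ∀ m, m ≠ k + 1 → φ m = ψ m := fun m h => Function.update_of_ne h ..
  have hφ : IsStoppingRule φ := by
    constructor
    · intro m
      rcases eq_or_ne m (k + 1) with rfl | h
      · rw [hφk]; exact measurable_one.indicator hA
      · rw [hφ_ne m h]; exact hψ.1 m
    · intro m x
      rcases eq_or_ne m (k + 1) with rfl | h
      · rw [hφk]; exact Set.indicator_le_self' (by simp) x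
      · rw [hφ_ne m h]; exact hψ.2 m x
  have hφt : t φ (k + 1) = t ψ (k + 1) := t_congr fun m h => hφ_ne m (by omega)
  have hφle : partialRisk μ c fb l (Vlim μ c fb l) (k + 1) φ ≤
      partialRisk μ c fb l (Vlim μ c fb l) k ψ := by
    rw [partialRisk_succ hfb hl (measurable_Vlim hm hl _) hφ, partialRisk, hφt, hφk]
    gcongr ?_ + ?_
    · refine (Finset.sum_congr rfl fun n hn => ?_).le
      have hnk := Finset.mem_range.1 hn
      rw [stopCost, stopCost, s_congr fun m hmn => hφ_ne m (by omega)]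
    · gcongr with x
      refine le_trans (le_of_eq ?_) (min_le_Vlim (k + 1) x)
      change _ * _ + _ * Qlim μ c fb l (k + 1) x = _
      by_cases hx : x ∈ A
      · simpa [hx] using (min_eq_left (show l (k + 1) x ≤ Qlim μ c fb l (k + 1) x from hx)).symm
      · simpa [hx] using (min_eq_right (not_le.1 (show ¬l (k + 1) x ≤ Qlim μ c fb l (k + 1) x from hx)).le).symm
  obtain ⟨ψ', hψ', hagree, hrisk⟩ := exists_risk_le_partialRisk_Vlim_add hfb hl hc hc' hφ (k + 1)
    (ne_top_of_le_ne_top hk hφle) one_ne_zero one_ne_top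
  have hfin : risk μ c fb l ψ' < ⊤ := hrisk.trans_lt
    (add_lt_top.2 ⟨hφle.trans_lt hk.lt_top, one_lt_top⟩)
  obtain ⟨N, hN, hkN⟩ := (((htend ψ' hψ').eventually (gt_mem_nhds hfin)).and
    (eventually_ge_atTop (k + 1))).exists
  have hV := measurable_V' (μ := μ) (c := c) hm hl (N + 1) (k + 2)
  have hint : ∫⁻ x, t ψ' (k + 2) x * V μ c fb l (N + 1) (k + 2) x ∂pm μ (k + 2) < ⊤ := by
    refine lt_of_le_of_lt ?_ ((partialRisk_V_le hfb hl hψ' hkN).trans_lt hN)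
    refine le_trans (lintegral_mono fun x => ?_) le_add_self
    gcongr
    exact le_add_self
  rw [lintegral_pm_succ μ (k + 1) ((measurable_t hψ' _).fun_mul hV)] at hint
  have hae := ae_lt_top (measurable_lintegral_snoc μ ((measurable_t hψ' _).fun_mul hV)) hint.ne
  filter_upwards [hae] with x hx htx
  refine le_antisymm (le_min ((Vlim_le 0 _ _).trans (V_le _ _ _)) ?_) (min_le_Vlim _ _)
  by_cases hxA : x ∈ A
  · exact ((Vlim_le 0 _ _).trans (V_le _ _ _)).trans hxA
  · refine Vlim_le_Q_of_lintegral_ne_top hm hl (N := N + 1) fun htop => hx.ne ?_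
    have hψt : t ψ' (k + 1) = t ψ (k + 1) :=
      (t_congr fun m h => hagree m (by omega)).trans hφt
    simp_rw [t_succ_snoc]
    rw [lintegral_const_mul _ (measurable_of_snoc_right hV x), hψt, hagree _ le_rfl, hφk, htop]
    simp [hxA, htx.ne']

end Truncatable

section Optimality

lemma mul_add_mul_eq_min_iff {p a b : ℝ≥0∞} (hp : p ≤ 1) (h : min a b ≠ ⊤) :
    p * a + (1 - p) * b = min a b ↔ (a < b → p = 1) ∧ (b < a → p = 0) := by
  have hp' : p ≠ ⊤ := ne_top_of_le_ne_top one_ne_top hp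
  have hsum : p + (1 - p) = 1 := add_tsub_cancel_of_le hp
  constructor
  · refine fun heq => ⟨fun hab => ?_, fun hba => ?_⟩
    · by_contra hp1
      rw [min_eq_left hab.le] at heq h
      have h0 : 1 - p ≠ 0 := (tsub_pos_of_lt (lt_of_le_of_ne hp hp1)).ne'
      have hlt : p * a + (1 - p) * a < p * a + (1 - p) * b :=
        ENNReal.add_lt_add_left (ENNReal.mul_ne_top hp' h)
          ((ENNReal.mul_lt_mul_iff_right h0 (by finiteness)).2 hab)
      rw [← add_mul, hsum, one_mul, heq] at hlt
      exact hlt.false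
    · by_contra hp0
      rw [min_eq_right hba.le] at heq h
      have hlt : p * b + (1 - p) * b < p * a + (1 - p) * b :=
        ENNReal.add_lt_add_right (ENNReal.mul_ne_top (by finiteness) h)
          ((ENNReal.mul_lt_mul_iff_right hp0 hp').2 hba)
      rw [← add_mul, hsum, one_mul, heq] at hlt
      exact hlt.false
  · rintro ⟨h1, h2⟩
    rcases lt_trichotomy a b with hab | rfl | hba
    · simp [h1 hab, hab.le]
    · rw [← add_mul, hsum, one_mul, min_self]
    · simp [h2 hba, hba.le]

lemma indicator_le_and_le_indicator_iff {α : Type*} {a b : α → ℝ≥0∞} {x : α} {p : ℝ≥0∞}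
    (hp : p ≤ 1) :
    ({y | a y < b y}.indicator 1 x ≤ p ∧ p ≤ {y | a y ≤ b y}.indicator 1 x) ↔
      (a x < b x → p = 1) ∧ (b x < a x → p = 0) := by
  rcases lt_trichotomy (a x) (b x) with h | h | h
  · simpa [h, h.le, h.not_gt, hp] using hp.ge_iff_eq
  · simp [h, hp]
  · simp [h, h.not_ge, h.not_gt]

variable {μ : Measure X} {c : ℝ≥0∞} {fb l : ∀ n, (Fin n → X) → ℝ≥0∞}

lemma partialRisk_Vlim_zero_ne_top (hfb : IsConsistentDensity μ fb) (hc' : c ≠ ⊤)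
    (hl1 : ∫⁻ x, l 1 x ∂pm μ 1 < ⊤) : partialRisk μ c fb l (Vlim μ c fb l) 0 ψ ≠ ⊤ := by
  have h : partialRisk μ c fb l (Vlim μ c fb l) 0 ψ ≤ c + ∫⁻ x, l 1 x ∂pm μ 1 := by
    have hc1 : c = ∫⁻ x, c * fb 1 x ∂pm μ 1 := by
      rw [lintegral_const_mul _ (hfb.measurable 1), hfb.lintegral_eq_one, mul_one]
    conv_rhs => rw [hc1]
    rw [← lintegral_add_left (measurable_const.fun_mul (hfb.measurable 1))]
    simp only [partialRisk, Finset.range_zero, Finset.sum_empty, zero_add, t, Nat.cast_zero,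
      one_mul, mul_one]
    gcongr with x
    exact (Vlim_le 0 _ _).trans (V_le _ _ _)
  exact ne_top_of_le_ne_top (by finiteness) h

variable [SigmaFinite μ]

lemma partialRisk_Vlim_succ (hfb : IsConsistentDensity μ fb) (hl : ∀ n, Measurable (l n))
    (hψ : IsStoppingRule ψ) (k : ℕ) :
    partialRisk μ c fb l (Vlim μ c fb l) (k + 1) ψ =
      ∑ n ∈ Finset.range k, stopCost μ c fb l ψ n +
        ∫⁻ x, t ψ (k + 1) x * (c * ((k : ℝ≥0∞) + 1) * fb (k + 1) x +
          (ψ (k + 1) x * l (k + 1) x + (1 - ψ (k + 1) x) * Qlim μ c fb l (k + 1) x))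
          ∂pm μ (k + 1) :=
  partialRisk_succ hfb hl (measurable_Vlim hfb.measurable hl _) hψ

lemma iInf_risk_eq (hfb : IsConsistentDensity μ fb) (hl : ∀ n, Measurable (l n))
    (hc : 0 < c) (hc' : c ≠ ⊤) (hl1 : ∫⁻ x, l 1 x ∂pm μ 1 < ⊤)
    (htend : ∀ φ : ∀ n, (Fin n → X) → ℝ≥0∞, IsStoppingRule φ →
      Tendsto (fun N => partialRisk μ c fb l l N φ) atTop (nhds (risk μ c fb l φ)))
    (hψ : IsStoppingRule ψ) :
    (⨅ (φ : ∀ n, (Fin n → X) → ℝ≥0∞) (_ : IsStoppingRule φ), risk μ c fb l φ) =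
      partialRisk μ c fb l (Vlim μ c fb l) 0 ψ := by
  refine le_antisymm (ENNReal.le_of_forall_pos_le_add fun ε hε _ => ?_)
    (le_iInf₂ fun φ hφ => ?_)
  · obtain ⟨φ, hφ, -, hle⟩ := exists_risk_le_partialRisk_Vlim_add hfb hl hc hc' hψ 0
      (partialRisk_Vlim_zero_ne_top hfb hc' hl1) (ε := ε) (by simpa using hε.ne') (by simp)
    exact (iInf₂_le φ hφ).trans hle
  · exact partialRisk_Vlim_le hfb hl hφ (htend φ hφ) 0

theorem risk_eq_iInf_iff (hfb : IsConsistentDensity μ fb) (hl : ∀ n, Measurable (l n))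
    (hc : 0 < c) (hc' : c ≠ ⊤) (hl1 : ∫⁻ x, l 1 x ∂pm μ 1 < ⊤)
    (htend : ∀ φ : ∀ n, (Fin n → X) → ℝ≥0∞, IsStoppingRule φ →
      Tendsto (fun N => partialRisk μ c fb l l N φ) atTop (nhds (risk μ c fb l φ)))
    (hψ : IsStoppingRule ψ) :
    risk μ c fb l ψ =
        (⨅ (φ : ∀ n, (Fin n → X) → ℝ≥0∞) (_ : IsStoppingRule φ), risk μ c fb l φ) ↔
      ∀ k : ℕ, ∀ᵐ x ∂pm μ (k + 1), 0 < t ψ (k + 1) x →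
        (l (k + 1) x < Qlim μ c fb l (k + 1) x → ψ (k + 1) x = 1) ∧
          (Qlim μ c fb l (k + 1) x < l (k + 1) x → ψ (k + 1) x = 0) := by
  have hm := hfb.measurable
  have ht := measurable_t hψ
  have hψm := hψ.1
  have hVm := measurable_Vlim (μ := μ) (c := c) hm hl
  have hQm := measurable_Qlim (μ := μ) (c := c) hm hl
  have hv := partialRisk_Vlim_zero_ne_top (ψ := ψ) hfb hc' hl1
  have htop : ∀ k, partialRisk μ c fb l (Vlim μ c fb l) k ψ ≠ ⊤ →
      ∀ᵐ x ∂pm μ (k + 1), 0 < t ψ (k + 1) x →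
        c * ((k : ℝ≥0∞) + 1) * fb (k + 1) x + Vlim μ c fb l (k + 1) x ≠ ⊤ := by
    intro k hk
    filter_upwards [ae_lt_top (by fun_prop) (ne_top_of_le_ne_top hk le_add_self)]
      with x hx htx hx'
    simp [hx', htx.ne'] at hx
  rw [iInf_risk_eq hfb hl hc hc' hl1 htend hψ]
  constructor
  · intro heq
    have hle : ∀ k, partialRisk μ c fb l (Vlim μ c fb l) k ψ ≤
        partialRisk μ c fb l (Vlim μ c fb l) 0 ψ := fun k =>
      heq ▸ partialRisk_Vlim_le hfb hl hψ (htend ψ hψ) k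
    have hfin : ∀ k, partialRisk μ c fb l (Vlim μ c fb l) k ψ ≠ ⊤ := fun k =>
      ne_top_of_le_ne_top hv (hle k)
    have hae : ∀ k, ∀ᵐ x ∂pm μ (k + 1),
        t ψ (k + 1) x * (c * ((k : ℝ≥0∞) + 1) * fb (k + 1) x + Vlim μ c fb l (k + 1) x) ≤
        t ψ (k + 1) x * (c * ((k : ℝ≥0∞) + 1) * fb (k + 1) x +
          (ψ (k + 1) x * l (k + 1) x + (1 - ψ (k + 1) x) * Qlim μ c fb l (k + 1) x)) := by
      intro k
      filter_upwards [Vlim_eq_min_ae hfb hl hc hc' htend hψ (hfin k)] with x hx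
      rcases eq_zero_or_pos (t ψ (k + 1) x) with h0 | h0
      · simp [h0]
      · rw [hx h0]
        gcongr
        exact min_le_mul_add_mul (hψ.2 _ _)
    have hge : ∀ k, partialRisk μ c fb l (Vlim μ c fb l) 0 ψ ≤
        partialRisk μ c fb l (Vlim μ c fb l) k ψ := by
      intro k
      induction k with
      | zero => exact le_rfl
      | succ k ih =>
        refine ih.trans ?_
        rw [partialRisk_Vlim_succ hfb hl hψ, partialRisk]
        gcongr 1
        exact lintegral_mono_ae (hae k)
    intro k
    have hint := (hle (k + 1)).trans (hge k)
    have hfk := hfin k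
    rw [partialRisk] at hfk
    rw [partialRisk_Vlim_succ hfb hl hψ, partialRisk,
      ENNReal.add_le_add_iff_left (ne_top_of_le_ne_top hfk le_self_add)] at hint
    have heq' := ae_eq_of_ae_le_of_lintegral_le (hae k)
      (ne_top_of_le_ne_top hfk le_add_self) (by fun_prop) hint
    filter_upwards [heq', htop k (hfin k),
      Vlim_eq_min_ae hfb hl hc hc' htend hψ (hfin k)] with x hx hxtop hxV htx
    have htx' : t ψ (k + 1) x ≠ ⊤ := ne_top_of_le_ne_top one_ne_top (t_le_one _ _ _)
    have h1 := hxtop htx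
    rw [ENNReal.mul_right_inj htx.ne' htx',
      ENNReal.add_right_inj (ne_top_of_le_ne_top h1 le_self_add), hxV htx] at hx
    rw [hxV htx] at h1
    exact (mul_add_mul_eq_min_iff (hψ.2 _ _) (ne_top_of_le_ne_top h1 le_add_self)).1 hx.symm
  · intro hcond
    have heq : ∀ k, partialRisk μ c fb l (Vlim μ c fb l) k ψ =
        partialRisk μ c fb l (Vlim μ c fb l) 0 ψ := by
      intro k
      induction k with
      | zero => rfl
      | succ k ih =>
        have hk : partialRisk μ c fb l (Vlim μ c fb l) k ψ ≠ ⊤ := ih ▸ hv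
        rw [← ih, partialRisk_Vlim_succ hfb hl hψ, partialRisk]
        congr 1
        refine lintegral_congr_ae ?_
        filter_upwards [htop k hk, Vlim_eq_min_ae hfb hl hc hc' htend hψ hk, hcond k]
          with x hxtop hxV hx
        rcases eq_zero_or_pos (t ψ (k + 1) x) with h0 | h0
        · simp [h0]
        · have h1 := hxtop h0
          rw [hxV h0] at h1
          rw [hxV h0, (mul_add_mul_eq_min_iff (hψ.2 _ _)
            (ne_top_of_le_ne_top h1 le_add_self)).2 (hx h0)]
    exact le_antisymm
      (risk_le_of_partialRisk_le hfb hψ hc hc' hv (k₀ := 0) fun k _ => (heq k).le)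
      (partialRisk_Vlim_le hfb hl hψ (htend ψ hψ) 0)

end Optimality

section Mixture

variable {μ : Measure X} {π₂ : Measure Θ} {f : Θ → ∀ n, (Fin n → X) → ℝ≥0∞}

lemma RN_succ (c : ℝ≥0∞) (l : ∀ n, (Fin n → X) → ℝ≥0∞) (N : ℕ) :
    RN π₂ μ c f l (N + 1) ψ = partialRisk μ c (fbar π₂ f) l l N ψ := by
  simp [RN, partialRisk, stopCost]

variable [SigmaFinite μ] [IsProbabilityMeasure π₂]

lemma lintegral_mul_fbar (hf : IsDensityFamily μ f) (n : ℕ) {g : (Fin n → X) → ℝ≥0∞}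
    (hg : Measurable g) :
    ∫⁻ θ, ∫⁻ x, g x * f θ n x ∂pm μ n ∂π₂ = ∫⁻ x, g x * fbar π₂ f n x ∂pm μ n := by
  have : SigmaFinite (pm μ n) := by unfold pm; infer_instance
  rw [lintegral_lintegral_swap
    ((hg.comp measurable_snd).fun_mul (hf.1 n) :
      Measurable fun p : Θ × (Fin n → X) => g p.2 * f p.1 n p.2).aemeasurable]
  refine lintegral_congr fun x => ?_
  rw [fbar, lintegral_const_mul _ ((hf.1 n).fun_comp measurable_prodMk_right)]

lemma IsDensityFamily.isConsistentDensity_fbar (hf : IsDensityFamily μ f) :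
    IsConsistentDensity μ (fbar π₂ f) where
  measurable n := (hf.1 n).lintegral_prod_left'
  lintegral_eq_one n := by
    have h := lintegral_mul_fbar (π₂ := π₂) hf n (measurable_const (a := 1))
    simp only [one_mul, hf.2.2.1, lintegral_one, measure_univ] at h
    exact h.symm
  lintegral_snoc n x := by
    simp_rw [fbar]
    rw [lintegral_lintegral_swap]
    · simp_rw [hf.2.2.2]
    · exact ((hf.1 (n + 1)).comp (measurable_snd.prodMk
        (((measurable_snoc n).comp measurable_prodMk_left).comp measurable_fst))).aemeasurable

lemma R_eq_risk (hf : IsDensityFamily μ f) (c : ℝ≥0∞) (l : ∀ n, (Fin n → X) → ℝ≥0∞)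
    (hψ : IsStoppingRule ψ) : R π₂ μ c f l ψ = risk μ c (fbar π₂ f) l ψ := by
  have h : Pfin π₂ μ f ψ =
      ∑' n : ℕ, ∫⁻ x, s ψ (n + 1) x * fbar π₂ f (n + 1) x ∂pm μ (n + 1) :=
    tsum_congr fun n => lintegral_mul_fbar hf _ (measurable_s hψ _)
  rw [R, risk, h]
  rfl

end Mixture

end Truncation

end SDP

open SDP MeasureTheory ENNReal Filter in
/-- if every stopping rule is truncatable and `𝓕` is the set of all stopping
rules, then `R(ψ) = inf_{ψ'∈𝓕} R(ψ')` iff `1{lₙ < Qₙ} ≤ ψₙ ≤ 1{lₙ ≤ Qₙ}` `μⁿ`-a.e. on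
`Tₙ^ψ` for every `n ≥ 1`. -/
theorem statement_14
    {Θ X D : Type*} [MeasurableSpace Θ] [MeasurableSpace X] [MeasurableSpace D]
    (μ : Measure X) [SigmaFinite μ]
    (π₁ π₂ : Measure Θ) [IsProbabilityMeasure π₁] [IsProbabilityMeasure π₂]
    (f : Θ → ∀ n, (Fin n → X) → ℝ≥0∞) (hf : IsDensityFamily μ f)
    (w : Θ → D → ℝ≥0∞) (hw : Measurable (Function.uncurry w))
    (δB : ∀ n, (Fin n → X) → D) (hδB : IsDecisionRule δB)
    (hBayes : ∀ n (d : D), ∀ᵐ x ∂pm μ n,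
      ∫⁻ θ, w θ (δB n x) * f θ n x ∂π₁ ≤ ∫⁻ θ, w θ d * f θ n x ∂π₁)
    (l : ∀ n, (Fin n → X) → ℝ≥0∞)
    (hl : ∀ n x, l n x = ∫⁻ θ, w θ (δB n x) * f θ n x ∂π₁)
    (hl1 : ∫⁻ x, l 1 x ∂pm μ 1 < ⊤)
    (c : ℝ≥0∞) (hc : 0 < c) (hc' : c ≠ ⊤)
    -- every stopping rule is truncatable
    (htrunc : ∀ ψ : ∀ n, (Fin n → X) → ℝ≥0∞, IsStoppingRule ψ →
      Tendsto (fun N => RN π₂ μ c f l N ψ) atTop (nhds (R π₂ μ c f l ψ)))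
    (ψ : ∀ n, (Fin n → X) → ℝ≥0∞) (hψ : IsStoppingRule ψ) :
    R π₂ μ c f l ψ =
        (⨅ (ψ' : ∀ n, (Fin n → X) → ℝ≥0∞) (_ : IsStoppingRule ψ'), R π₂ μ c f l ψ') ↔
      ∀ n : ℕ, 1 ≤ n → ∀ᵐ x ∂pm μ n, 0 < t ψ n x →
        ({y : Fin n → X | l n y < Qlim μ c (fbar π₂ f) l n y}.indicator 1 x ≤ ψ n x ∧
          ψ n x ≤ {y : Fin n → X | l n y ≤ Qlim μ c (fbar π₂ f) l n y}.indicator 1 x) := by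
  have hlm : ∀ n, Measurable (l n) := by
    intro n
    rw [funext (hl n)]
    exact ((hw.comp (measurable_fst.prodMk ((hδB n).comp measurable_snd))).fun_mul
      (hf.1 n) : Measurable fun p : Θ × (Fin n → X) =>
        w p.1 (δB n p.2) * f p.1 n p.2).lintegral_prod_left'
  have htend : ∀ φ : ∀ n, (Fin n → X) → ℝ≥0∞, IsStoppingRule φ →
      Tendsto (fun N => partialRisk μ c (fbar π₂ f) l l N φ) atTop
        (nhds (risk μ c (fbar π₂ f) l φ)) := by
    intro φ hφ
    rw [← R_eq_risk hf c l hφ]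
    simp_rw [← RN_succ]
    exact (tendsto_add_atTop_iff_nat 1).2 (htrunc φ hφ)
  have hinf : (⨅ (ψ' : ∀ n, (Fin n → X) → ℝ≥0∞) (_ : IsStoppingRule ψ'), R π₂ μ c f l ψ') =
      ⨅ (ψ' : ∀ n, (Fin n → X) → ℝ≥0∞) (_ : IsStoppingRule ψ'),
        risk μ c (fbar π₂ f) l ψ' :=
    iInf_congr fun ψ' => iInf_congr fun hψ' => R_eq_risk hf c l hψ'
  rw [hinf, R_eq_risk hf c l hψ,
    risk_eq_iInf_iff hf.isConsistentDensity_fbar hlm hc hc' hl1 htend hψ]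
  simp_rw [indicator_le_and_le_indicator_iff (hψ.2 _ _)]
  refine ⟨fun h n hn => ?_, fun h k => h (k + 1) k.succ_pos⟩
  obtain ⟨k, rfl⟩ := Nat.exists_eq_add_of_le' hn
  exact h k
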